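/- There is a schema of M-clause sets C^n = {{l1^n}, {l2, l3}, {l4^n}} with l1^n = (P, (α1,α2), {[(α1,α2)\(x, f1 x)], …, [(α1,α2)\(x, fn x)]}), l2 = (¬P, (β1,β2), {[(β1,β2)\(x,y)]}), l3 = (P, (γ1,γ2), {[(γ1,γ2)\(x, f y)]}), and l4^n = (¬P, (δ1,δ2), {[(δ1,δ2)\(f x1, f x2)], …, [(δ1,δ2)\(f x_{n-1}, f x_n)]}), over a signature with a binary predicate P and unary function symbols f, f1, …, fn, such that for every n there is a closed M-tableau for C^n whose number of nodes is linear in n (O(n)). -/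

import Mathlib

namespace MTab

/-- Variables: ordinary variables and abstraction variables. -/
inductive Var : Type
  | ord : ℕ → Var
  | abs : ℕ → Var
  deriving DecidableEq

def Var.isAbs : Var → Prop
  | .abs _ => True
  | .ord _ => False

/-- First-order terms over function symbols `F`. -/
inductive Term (F : Type) : Type
  | var : Var → Term F
  | fn : F → List (Term F) → Term F

/-- Substitutions. -/
abbrev Subst (F : Type) := Var → Term F

def Term.subst {F : Type} (σ : Subst F) : Term F → Term F
  | .var v => σ v
  | .fn f ts => .fn f (ts.attach.map (fun x => Term.subst σ x.1))
  decreasing_by have := List.sizeOf_lt_of_mem x.2; simp only [Term.fn.sizeOf_spec]; omega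

def Term.varList {F : Type} : Term F → List Var
  | .var v => [v]
  | .fn _ ts => (ts.attach.map (fun x => Term.varList x.1)).flatten
  decreasing_by have := List.sizeOf_lt_of_mem x.2; simp only [Term.fn.sizeOf_spec]; omega

def Term.vars {F : Type} (t : Term F) : Set Var := {v | v ∈ t.varList}

def Subst.idS {F : Type} : Subst F := fun v => Term.var v

def Subst.dom {F : Type} (σ : Subst F) : Set Var := {v | σ v ≠ Term.var v}

def Subst.vars {F : Type} (σ : Subst F) : Set Var :=
  σ.dom ∪ {v | ∃ w ∈ σ.dom, v ∈ Term.vars (σ w)}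

/-- Full composition: apply `σ` first, then `τ`. -/
def Subst.comp {F : Type} (σ τ : Subst F) : Subst F := fun v => Term.subst τ (σ v)

open Classical in
/-- Composition of `σ` with `τ`, restricted to the domain of `σ`. -/
noncomputable def Subst.compOn {F : Type} (σ τ : Subst F) : Subst F :=
  fun v => if v ∈ σ.dom then Term.subst τ (σ v) else Term.var v

def argsVars {F : Type} (args : List (Term F)) : Set Var := {v | ∃ t ∈ args, v ∈ Term.vars t}

/-- Ordinary first-order literals over predicate symbols `P`
(`pol = true` for positive literals). -/
structure Lit (F P : Type) where
  pol : Bool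
  pred : P
  args : List (Term F)

def Lit.subst {F P : Type} (σ : Subst F) (l : Lit F P) : Lit F P :=
  ⟨l.pol, l.pred, l.args.map (Term.subst σ)⟩

/-- M-literals: `⊤` or a triple `(L, t, S)`. -/
inductive MLit (F P : Type)
  | top : MLit F P
  | lit (pol : Bool) (pred : P) (args : List (Term F)) (S : Set (Subst F)) : MLit F P

/-- The (common) domain of the substitution set of an M-literal. -/
def MLit.domS {F P : Type} : MLit F P → Set Var
  | .top => ∅
  | .lit _ _ _ S => {v | ∃ σ ∈ S, v ∈ Subst.dom σ}

/-- Side conditions in the definition of M-literals: all substitutions of `S` share a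
common domain `D` consisting of abstraction variables of the argument tuple, and
`Vars(t σ) ∩ D = ∅` for all `σ ∈ S`. -/
def MLit.WF {F P : Type} : MLit F P → Prop
  | .top => True
  | .lit _ _ args S =>
      (∀ σ ∈ S, ∀ τ ∈ S, Subst.dom σ = Subst.dom τ) ∧
      (∀ σ ∈ S, ∀ v ∈ Subst.dom σ, Var.isAbs v ∧ v ∈ argsVars args) ∧
      (∀ σ ∈ S, ∀ v ∈ Subst.dom σ, v ∉ argsVars (args.map (Term.subst σ)))

def MLit.finiteS {F P : Type} : MLit F P → Prop
  | .top => True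
  | .lit _ _ _ S => S.Finite

/-- All variables occurring in an M-literal. -/
def MLit.varsIn {F P : Type} : MLit F P → Set Var
  | .top => ∅
  | .lit _ _ args S => argsVars args ∪ {v | ∃ σ ∈ S, v ∈ Subst.vars σ}

/-- Semantics: `⊤` or a clause, a clause being identified with the set of its
literals (which accounts for associativity, commutativity and idempotence of `∨`). -/
inductive NF (F P : Type)
  | tru : NF F P
  | clause : Set (Lit F P) → NF F P

def MLit.semSet {F P : Type} : MLit F P → Set (Lit F P)
  | .top => ∅
  | .lit b p args S => {l | ∃ σ ∈ S, l = ⟨b, p, args.map (Term.subst σ)⟩}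

def MLit.sem {F P : Type} : MLit F P → NF F P
  | .top => .tru
  | .lit b p args S => .clause (MLit.semSet (.lit b p args S))

/-- M-clauses: sets of M-literals. -/
abbrev MClause (F P : Type) := Set (MLit F P)

open Classical in
noncomputable def MClause.sem {F P : Type} (C : MClause F P) : NF F P :=
  if MLit.top ∈ C then .tru else .clause {l | ∃ m ∈ C, l ∈ MLit.semSet m}

/-- Well-formed M-clauses: distinct M-literals have substitution sets with
disjoint domains. -/
def MClause.WellFormed {F P : Type} (C : MClause F P) : Prop :=
  ∀ l ∈ C, ∀ m ∈ C, l ≠ m → MLit.domS l ∩ MLit.domS m = ∅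

def GoodClauseSet {F P : Type} (𝒞 : Set (MClause F P)) : Prop :=
  ∀ C ∈ 𝒞, MClause.WellFormed C ∧ ∀ l ∈ C, MLit.WF l

def FiniteClauseSet {F P : Type} (𝒞 : Set (MClause F P)) : Prop :=
  ∀ C ∈ 𝒞, C.Finite ∧ ∀ l ∈ C, MLit.finiteS l

open Classical in
/-- Application of a substitution to an M-literal: the arguments are instantiated by the
restriction of `σ` to the variables not in `dom S`, and the substitutions of `S` are
composed with `σ`. -/
noncomputable def MLit.subst {F P : Type} (σ : Subst F) : MLit F P → MLit F P
  | .top => .top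
  | .lit b p args S =>
      .lit b p
        (args.map (Term.subst (fun v => if ∃ θ ∈ S, v ∈ Subst.dom θ then Term.var v else σ v)))
        ((fun θ => Subst.compOn θ σ) '' S)

/-- Renamings: injective, mapping ordinary variables to ordinary variables and
abstraction variables to abstraction variables. -/
def VarRenaming (ρ : Var → Var) : Prop :=
  Function.Injective ρ ∧ (∀ n, ∃ m, ρ (Var.ord n) = Var.ord m) ∧
    (∀ n, ∃ m, ρ (Var.abs n) = Var.abs m)

def renSubst {F : Type} (ρ : Var → Var) : Subst F := fun v => Term.var (ρ v)

open Classical in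
/-- Transport of a substitution along a renaming `ρ`. -/
noncomputable def Subst.renameBy {F : Type} (ρ : Var → Var) (σ : Subst F) : Subst F :=
  fun v => if h : ∃ w, ρ w = v then Term.subst (renSubst ρ) (σ h.choose) else Term.var v

/-- Renaming of an M-literal (all variables, including those of `dom S`, are renamed). -/
noncomputable def MLit.rename {F P : Type} (ρ : Var → Var) : MLit F P → MLit F P
  | .top => .top
  | .lit b p args S => .lit b p (args.map (Term.subst (renSubst ρ))) (Subst.renameBy ρ '' S)

noncomputable def MClause.rename {F P : Type} (ρ : Var → Var) (C : MClause F P) : MClause F P :=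
  MLit.rename ρ '' C

def MLit.head {F P : Type} : MLit F P → Option (Bool × P)
  | .top => none
  | .lit b p _ _ => some (b, p)

/-- Bundled normal form. -/
def MClause.BNF {F P : Type} (C : MClause F P) : Prop :=
  (∀ b p args S, MLit.lit b p args S ∈ C → S ≠ ∅) ∧
  (MLit.top ∈ C → C = {MLit.top}) ∧
  (∀ l ∈ C, ∀ m ∈ C, l ≠ m → MLit.head l ≠ MLit.head m)

end MTab
namespace MTab

/-- Pre-tableaux: trees labelled by M-literals. -/
inductive Tree (F P : Type)
  | node : MLit F P → List (Tree F P) → Tree F P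

def Tree.label {F P : Type} : Tree F P → MLit F P
  | .node l _ => l

def Tree.children {F P : Type} : Tree F P → List (Tree F P)
  | .node _ c => c

/-- The subtree of `t` at position `p` (a position is a list of child indices). -/
def Tree.subtreeAt {F P : Type} : List ℕ → Tree F P → Option (Tree F P)
  | [], t => some t
  | i :: p, .node _ cs => (cs[i]?).bind (Tree.subtreeAt p)

def Tree.labelAt {F P : Type} (p : List ℕ) (t : Tree F P) : Option (MLit F P) :=
  (Tree.subtreeAt p t).map Tree.label

def Tree.IsPos {F P : Type} (t : Tree F P) (p : List ℕ) : Prop :=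
  (Tree.subtreeAt p t).isSome

def Tree.IsLeafPos {F P : Type} (t : Tree F P) (p : List ℕ) : Prop :=
  ∃ l, Tree.subtreeAt p t = some (Tree.node l [])

/-- All variables occurring in the labels of a tree. -/
def Tree.varsIn {F P : Type} (t : Tree F P) : Set Var :=
  {v | ∃ p l, Tree.labelAt p t = some l ∧ v ∈ MLit.varsIn l}

noncomputable def Tree.substT {F P : Type} (σ : Subst F) : Tree F P → Tree F P
  | .node l c => .node (MLit.subst σ l) (c.attach.map (fun x => Tree.substT σ x.1))
  decreasing_by have := List.sizeOf_lt_of_mem x.2; simp only [Tree.node.sizeOf_spec]; omega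

/-- Replace the subtree at position `p` by `u`. -/
def Tree.replaceAt {F P : Type} : List ℕ → Tree F P → Tree F P → Tree F P
  | [], u, _ => u
  | i :: p, u, .node l cs =>
      .node l (match cs[i]? with
        | some tj => cs.set i (Tree.replaceAt p u tj)
        | none => cs)

/-- Change the label of the node at position `p` to `m`. -/
def Tree.relabelAt {F P : Type} : List ℕ → MLit F P → Tree F P → Tree F P
  | [], m, .node _ c => .node m c
  | i :: p, m, .node l cs =>
      .node l (match cs[i]? with
        | some tj => cs.set i (Tree.relabelAt p m tj)
        | none => cs)

/-- Add a new (last) child `u` to the node at position `p`. -/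
def Tree.appendChildAt {F P : Type} : List ℕ → Tree F P → Tree F P → Tree F P
  | [], u, .node l c => .node l (c ++ [u])
  | i :: p, u, .node l cs =>
      .node l (match cs[i]? with
        | some tj => cs.set i (Tree.appendChildAt p u tj)
        | none => cs)

/-- Number of nodes of a tree. -/
def Tree.size {F P : Type} : Tree F P → ℕ
  | .node _ c => 1 + ((c.attach.map (fun x => Tree.size x.1)).sum)
  decreasing_by have := List.sizeOf_lt_of_mem x.2; simp only [Tree.node.sizeOf_spec]; omega

/-- Number of leaves (branches) of a tree. -/
def Tree.leafCount {F P : Type} : Tree F P → ℕ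
  | .node _ [] => 1
  | .node _ (t :: ts) => (((t :: ts).attach.map (fun x => Tree.leafCount x.1)).sum)
  decreasing_by have := List.sizeOf_lt_of_mem x.2; simp only [Tree.node.sizeOf_spec]; omega

/-- Height of a tree (number of nodes on a longest branch). -/
def Tree.height {F P : Type} : Tree F P → ℕ
  | .node _ c => 1 + ((c.attach.map (fun x => Tree.height x.1)).foldr max 0)
  decreasing_by have := List.sizeOf_lt_of_mem x.2; simp only [Tree.node.sizeOf_spec]; omega

/-- `p` is a proper prefix of `q` (i.e. the node at `q` is a proper descendant
of the node at `p`). -/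
def ProperPrefix (p q : List ℕ) : Prop := p <+: q ∧ p ≠ q

def singleSubst {F : Type} (x : Var) (s : Term F) : Subst F :=
  fun v => if v = x then s else Term.var v

/-- The Expansion rule. -/
def ExpandStep {F P : Type} (𝒞 : Set (MClause F P)) (T T' : Tree F P) : Prop :=
  ∃ (p : List ℕ) (l : MLit F P) (C : MClause F P) (ρ : Var → Var) (ls : List (MLit F P)),
    Tree.subtreeAt p T = some (Tree.node l []) ∧
    C ∈ 𝒞 ∧ MLit.top ∉ C ∧ VarRenaming ρ ∧
    ls.Nodup ∧ {m | m ∈ ls} = MClause.rename ρ C ∧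
    (∀ m ∈ ls, MLit.varsIn m ∩ Tree.varsIn T = ∅) ∧
    T' = Tree.replaceAt p (Tree.node l (ls.map (fun m => Tree.node m []))) T

/-- The Instantiation rule: an ordinary variable `x` is instantiated by a term `s`,
provided every node whose label contains `x` is a proper descendant of every node
introducing an abstraction variable of `s`. -/
def InstStep {F P : Type} (T T' : Tree F P) : Prop :=
  ∃ (x : ℕ) (s : Term F),
    (∀ (p p' : List ℕ) (l l' : MLit F P),
        Tree.labelAt p T = some l → Tree.labelAt p' T = some l' →
        Var.ord x ∈ MLit.varsIn l →
        (∃ α, α ∈ MLit.domS l' ∧ α ∈ Term.vars s ∧ Var.isAbs α) →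
        ProperPrefix p' p) ∧
    T' = Tree.substT (singleSubst (Var.ord x) s) T

/-- The Separation rule, applied below the node at position `q`, on its `i`-th child `μ`
labelled `(L, t, S)`, with instantiation `θ` (so that `r = t θ`), splitting `S` into
`S1` (witnessed by the choice function `f` assigning to each `σ ∈ S1` the
corresponding `σ'`) and `S2 = S \ S1`. -/
def SepStep {F P : Type} (T : Tree F P) (q : List ℕ) (i : ℕ)
    (b : Bool) (pr : P) (args : List (Term F)) (S : Set (Subst F))
    (θ : Subst F) (f : Subst F → Subst F) (S1 S2 : Set (Subst F)) (T' : Tree F P) : Prop :=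
  ∃ (n μ : Tree F P),
    Tree.subtreeAt q T = some n ∧ n.children ≠ [] ∧
    (n.children)[i]? = some μ ∧ μ.label = MLit.lit b pr args S ∧
    Subst.dom θ = MLit.domS (MLit.lit b pr args S) ∧
    (∀ α, Var.isAbs α → α ∈ argsVars (args.map (Term.subst θ)) →
      α ∉ MLit.domS (MLit.lit b pr args S)) ∧
    S1 = {σ | σ ∈ S ∧ ∃ σ' : Subst F,
            args.map (Term.subst σ) = (args.map (Term.subst θ)).map (Term.subst σ') ∧
            ∀ v ∈ Subst.dom σ', Var.isAbs v ∧ v ∉ Tree.varsIn T} ∧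
    (∀ σ ∈ S1,
        args.map (Term.subst σ) = (args.map (Term.subst θ)).map (Term.subst (f σ)) ∧
        ∀ v ∈ Subst.dom (f σ), Var.isAbs v ∧ v ∉ Tree.varsIn T) ∧
    S1 ≠ ∅ ∧ S2 = S \ S1 ∧
    T' = Tree.appendChildAt q (Tree.node (MLit.lit b pr args S2) [])
          (Tree.relabelAt (q ++ [i]) (MLit.lit b pr (args.map (Term.subst θ)) (f '' S1))
            (Tree.substT θ T))

/-- M-tableaux for a set of M-clauses. -/
inductive MTableau {F P : Type} (𝒞 : Set (MClause F P)) : Tree F P → Prop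
  | init : MTableau 𝒞 (Tree.node MLit.top [])
  | expand {T T' : Tree F P} : MTableau 𝒞 T → ExpandStep 𝒞 T T' → MTableau 𝒞 T'
  | inst {T T' : Tree F P} : MTableau 𝒞 T → InstStep T T' → MTableau 𝒞 T'
  | sep {T T' : Tree F P} : MTableau 𝒞 T →
      (∃ q i b pr args S θ f S1 S2, SepStep T q i b pr args S θ f S1 S2 T') →
      MTableau 𝒞 T'

/-- `false` literals: M-literals with an empty substitution set. -/
def MLit.isFalse {F P : Type} : MLit F P → Prop
  | .top => False
  | .lit _ _ _ S => S = ∅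

/-- Closedness of the branch ending at leaf position `lp`. -/
def ClosedBranch {F P : Type} (T : Tree F P) (lp : List ℕ) : Prop :=
  (∃ q l, q <+: lp ∧ Tree.labelAt q T = some l ∧ MLit.isFalse l) ∨
  (∃ q1 q2 pr args S1 S2, q1 <+: lp ∧ q2 <+: lp ∧
    Tree.labelAt q1 T = some (MLit.lit true pr args S1) ∧
    Tree.labelAt q2 T = some (MLit.lit false pr args S2))

def ClosedTree {F P : Type} (T : Tree F P) : Prop :=
  ∀ p, Tree.IsLeafPos T p → ClosedBranch T p

/-- First-order interpretations. -/
structure Interp (F P : Type) where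
  carrier : Type
  nonempty : Nonempty carrier
  fI : F → List carrier → carrier
  pI : P → List carrier → Prop

def Term.eval {F P : Type} (I : Interp F P) (ν : Var → I.carrier) : Term F → I.carrier
  | .var v => ν v
  | .fn f ts => I.fI f (ts.attach.map (fun x => Term.eval I ν x.1))
  decreasing_by have := List.sizeOf_lt_of_mem x.2; simp only [Term.fn.sizeOf_spec]; omega

def Lit.holds {F P : Type} (I : Interp F P) (ν : Var → I.carrier) (l : Lit F P) : Prop :=
  if l.pol then I.pI l.pred (l.args.map (Term.eval I ν))
  else ¬ I.pI l.pred (l.args.map (Term.eval I ν))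

/-- Satisfaction of a (universally closed) clause, or of `true`. -/
def Interp.satNF {F P : Type} (I : Interp F P) : NF F P → Prop
  | .tru => True
  | .clause c => ∀ ν : Var → I.carrier, ∃ l ∈ c, Lit.holds I ν l

/-- `⟦𝒞⟧` is unsatisfiable. -/
def Unsat {F P : Type} (𝒞 : Set (MClause F P)) : Prop :=
  ¬ ∃ I : Interp F P, ∀ C ∈ 𝒞, I.satNF (MClause.sem C)

/-- Disjunction of `NF` formulas. -/
def NF.or {F P : Type} : NF F P → NF F P → NF F P
  | .tru, _ => .tru
  | .clause _, .tru => .tru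
  | .clause s, .clause s' => .clause (s ∪ s')

def NF.disj {F P : Type} (l : List (NF F P)) : NF F P := l.foldr NF.or (NF.clause ∅)

/-- Applying a substitution to an `NF` formula (instances of a formula). -/
def NF.substApp {F P : Type} (σ : Subst F) : NF F P → NF F P
  | .tru => .tru
  | .clause s => .clause (Lit.subst σ '' s)

end MTab
namespace MTab

/-! The schema of M-clause sets `𝒞ⁿ = {{l1ⁿ}, {l2, l3}, {l4ⁿ}}`, over the signature
with a binary predicate `P` (the unique element of `Unit`) and unary function symbols
encoded by `ℕ` (`0` encodes `f`, and `i` encodes `fᵢ` for `1 ≤ i ≤ n`). -/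

/-- the ordinary variable `x` -/
def xv : Var := Var.ord 0
/-- the ordinary variable `y` -/
def yv : Var := Var.ord 1
/-- the ordinary variables `x₁, …, xₙ` -/
def xi (i : ℕ) : Var := Var.ord (i + 1)

def av1 : Var := Var.abs 0
def av2 : Var := Var.abs 1
def bv1 : Var := Var.abs 2
def bv2 : Var := Var.abs 3
def gv1 : Var := Var.abs 4
def gv2 : Var := Var.abs 5
def dv1 : Var := Var.abs 6
def dv2 : Var := Var.abs 7

/-- the substitution `[(a, b) \ (s, t)]` -/
def upd2 (a b : Var) (s t : Term ℕ) : Subst ℕ :=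
  fun v => if v = a then s else if v = b then t else Term.var v

/-- application of the unary function symbol `i` -/
def fT (i : ℕ) (t : Term ℕ) : Term ℕ := Term.fn i [t]

/-- `l1ⁿ = (P, (α₁,α₂), {[(α₁,α₂)\(x, f₁ x)], …, [(α₁,α₂)\(x, fₙ x)]})` -/
def l1 (n : ℕ) : MLit ℕ Unit :=
  MLit.lit true () [Term.var av1, Term.var av2]
    {σ | ∃ i, 1 ≤ i ∧ i ≤ n ∧ σ = upd2 av1 av2 (Term.var xv) (fT i (Term.var xv))}

/-- `l2 = (¬P, (β₁,β₂), {[(β₁,β₂)\(x,y)]})` -/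
def l2 : MLit ℕ Unit :=
  MLit.lit false () [Term.var bv1, Term.var bv2]
    {upd2 bv1 bv2 (Term.var xv) (Term.var yv)}

/-- `l3 = (P, (γ₁,γ₂), {[(γ₁,γ₂)\(x, f y)]})` -/
def l3 : MLit ℕ Unit :=
  MLit.lit true () [Term.var gv1, Term.var gv2]
    {upd2 gv1 gv2 (Term.var xv) (fT 0 (Term.var yv))}

/-- `l4ⁿ = (¬P, (δ₁,δ₂), {[(δ₁,δ₂)\(f x₁, f x₂)], …, [(δ₁,δ₂)\(f xₙ₋₁, f xₙ)]})` -/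
def l4 (n : ℕ) : MLit ℕ Unit :=
  MLit.lit false () [Term.var dv1, Term.var dv2]
    {σ | ∃ i, 1 ≤ i ∧ i + 1 ≤ n ∧
      σ = upd2 dv1 dv2 (fT 0 (Term.var (xi i))) (fT 0 (Term.var (xi (i + 1))))}

/-- `𝒞ⁿ = {{l1ⁿ}, {l2, l3}, {l4ⁿ}}` -/
def Cn (n : ℕ) : Set (MClause ℕ Unit) := {{l1 n}, {l2, l3}, {l4 n}}

/-! ### Basic facts on terms and substitutions -/

theorem Term.subst_fn {F : Type} (σ : Subst F) (f : F) (ts : List (Term F)) :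
    Term.subst σ (.fn f ts) = .fn f (ts.map (Term.subst σ)) := by
  rw [Term.subst]; congr 1; simp

theorem Term.mem_vars_fn {F : Type} (f : F) (ts : List (Term F)) (v : Var) :
    v ∈ Term.vars (.fn f ts) ↔ ∃ t ∈ ts, v ∈ Term.vars t := by
  simp only [Term.vars, Set.mem_ofPred_eq]
  rw [Term.varList]; simp

theorem Term.mem_vars_var {F : Type} (w v : Var) :
    v ∈ Term.vars (F := F) (.var w) ↔ v = w := by
  simp only [Term.vars, Set.mem_ofPred_eq]
  rw [Term.varList]; simp

theorem Term.subst_var {F : Type} (σ : Subst F) (v : Var) :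
    Term.subst σ (.var v) = σ v := by rw [Term.subst]

theorem Term.subst_fix {F : Type} (σ : Subst F) : ∀ t : Term F,
    (∀ v ∈ Term.vars t, σ v = Term.var v) → Term.subst σ t = t
  | .var v, h => by rw [Term.subst_var]; exact h v ((Term.mem_vars_var v v).2 rfl)
  | .fn f ts, h => by
    rw [Term.subst_fn]
    congr 1
    conv_rhs => rw [← List.map_id ts]
    apply List.map_congr_left
    intro t ht
    exact Term.subst_fix σ t (fun v hv => h v ((Term.mem_vars_fn f ts v).2 ⟨t, ht, hv⟩))
  termination_by t => sizeOf t
  decreasing_by have := List.sizeOf_lt_of_mem ht; simp only [Term.fn.sizeOf_spec]; omega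

theorem fT_subst (σ : Subst ℕ) (i : ℕ) (t : Term ℕ) :
    Term.subst σ (fT i t) = fT i (Term.subst σ t) := by
  simp [fT, Term.subst_fn]

theorem mem_vars_fT (i : ℕ) (t : Term ℕ) (v : Var) :
    v ∈ Term.vars (fT i t) ↔ v ∈ Term.vars t := by
  simp [fT, Term.mem_vars_fn]

theorem fT_inj {i j : ℕ} {s t : Term ℕ} : fT i s = fT j t ↔ i = j ∧ s = t := by
  simp [fT]

theorem Subst.compOn_fix {F : Type} (θ σ : Subst F)
    (h : ∀ v ∈ Subst.vars θ, σ v = Term.var v) : Subst.compOn θ σ = θ := by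
  funext v
  unfold Subst.compOn
  split_ifs with hv
  · exact Term.subst_fix _ _ (fun w hw => h w (Or.inr ⟨v, hv, hw⟩))
  · simp only [Subst.dom, Set.mem_ofPred_eq, not_not] at hv
    exact hv.symm

theorem MLit.subst_fix {F P : Type} (σ : Subst F) (m : MLit F P)
    (h : ∀ v ∈ MLit.varsIn m, σ v = Term.var v) : MLit.subst σ m = m := by
  cases m with
  | top => rfl
  | lit b p args S =>
    simp only [MLit.subst]
    congr 1
    · conv_rhs => rw [← List.map_id args]
      apply List.map_congr_left
      intro t ht
      apply Term.subst_fix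
      intro v hv
      split_ifs
      · rfl
      · exact h v (Or.inl ⟨t, ht, hv⟩)
    · conv_rhs => rw [← Set.image_id S]
      apply Set.image_congr
      intro θ hθ
      exact Subst.compOn_fix θ σ (fun v hv => h v (Or.inr ⟨θ, hθ, hv⟩))

theorem idS_dom {F : Type} : Subst.dom (Subst.idS : Subst F) = ∅ := by
  ext v; simp [Subst.dom, Subst.idS]

theorem Term.subst_idS {F : Type} (t : Term F) : Term.subst Subst.idS t = t :=
  Term.subst_fix _ _ (fun _ _ => rfl)

/-! ### Caterpillar trees -/

/-- A frame: an inner node with leaf siblings of the distinguished child. -/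
structure Frame where
  lab : MLit ℕ Unit
  left : List (MLit ℕ Unit)
  right : List (MLit ℕ Unit)

def leaf (m : MLit ℕ Unit) : Tree ℕ Unit := .node m []

def plug : List Frame → MLit ℕ Unit → List (MLit ℕ Unit) → Tree ℕ Unit
  | [], l, ms => .node l (ms.map leaf)
  | f :: fs, l, ms => .node f.lab (f.left.map leaf ++ plug fs l ms :: f.right.map leaf)

def pos (fs : List Frame) : List ℕ := fs.map (fun f => f.left.length)

theorem get_mid {α : Type} (a b : List α) (x : α) (n : ℕ) (h : n = a.length) :
    (a ++ x :: b)[n]? = some x := by subst h; simp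

theorem set_mid {α : Type} (a b : List α) (x y : α) (n : ℕ) (h : n = a.length) :
    (a ++ x :: b).set n y = a ++ y :: b := by subst h; simp

theorem plug_append (fs : List Frame) (l m : MLit ℕ Unit) (m1 m2 : List (MLit ℕ Unit)) :
    plug fs l (m1 ++ m :: m2) = plug (fs ++ [⟨l, m1, m2⟩]) m [] := by
  induction fs with
  | nil => simp [plug, leaf]
  | cons f fs ih => simp [plug, ih]

theorem subtreeAt_plug (fs : List Frame) (l : MLit ℕ Unit) (ms : List (MLit ℕ Unit))
    (r : List ℕ) :
    Tree.subtreeAt (pos fs ++ r) (plug fs l ms) = Tree.subtreeAt r (.node l (ms.map leaf)) := by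
  induction fs with
  | nil => simp [plug, pos]
  | cons f fs ih =>
    simp only [pos, List.map_cons, List.cons_append, plug, Tree.subtreeAt]
    rw [get_mid _ _ _ _ (by simp)]
    exact ih

theorem replaceAt_plug (fs : List Frame) (l l' : MLit ℕ Unit) (ms ms' : List (MLit ℕ Unit)) :
    Tree.replaceAt (pos fs) (.node l' (ms'.map leaf)) (plug fs l ms) = plug fs l' ms' := by
  induction fs with
  | nil => simp [plug, pos, Tree.replaceAt]
  | cons f fs ih =>
    simp only [pos, List.map_cons, plug, Tree.replaceAt]
    rw [get_mid _ _ _ _ (by simp)]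
    simp only
    rw [set_mid _ _ _ _ _ (by simp)]
    rw [show List.map (fun f => f.left.length) fs = pos fs from rfl, ih]

theorem relabelAt_plug (fs : List Frame) (l m m' : MLit ℕ Unit) (m1 m2 : List (MLit ℕ Unit)) :
    Tree.relabelAt (pos fs ++ [m1.length]) m' (plug fs l (m1 ++ m :: m2))
      = plug fs l (m1 ++ m' :: m2) := by
  induction fs with
  | nil =>
    simp only [plug, pos, List.map_nil, List.nil_append, Tree.relabelAt, List.map_append,
      List.map_cons]
    rw [get_mid _ _ _ _ (by simp)]
    simp only
    rw [set_mid _ _ _ _ _ (by simp)]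
    rfl
  | cons f fs ih =>
    simp only [pos, List.map_cons, List.cons_append, plug, Tree.relabelAt]
    rw [get_mid _ _ _ _ (by simp)]
    simp only
    rw [set_mid _ _ _ _ _ (by simp)]
    rw [show List.map (fun f => f.left.length) fs = pos fs from rfl, ih]

theorem appendChildAt_plug (fs : List Frame) (l m : MLit ℕ Unit) (ms : List (MLit ℕ Unit)) :
    Tree.appendChildAt (pos fs) (.node m []) (plug fs l ms) = plug fs l (ms ++ [m]) := by
  induction fs with
  | nil => simp [plug, pos, Tree.appendChildAt, leaf]
  | cons f fs ih =>
    simp only [pos, List.map_cons, plug, Tree.appendChildAt]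
    rw [get_mid _ _ _ _ (by simp)]
    simp only
    rw [set_mid _ _ _ _ _ (by simp)]
    rw [show List.map (fun f => f.left.length) fs = pos fs from rfl, ih]

theorem substT_node {F P : Type} (σ : Subst F) (l : MLit F P) (c : List (Tree F P)) :
    Tree.substT σ (.node l c) = .node (MLit.subst σ l) (c.map (Tree.substT σ)) := by
  rw [Tree.substT]; congr 1; simp

theorem substT_leaf (σ : Subst ℕ) (m : MLit ℕ Unit) :
    Tree.substT σ (leaf m) = leaf (MLit.subst σ m) := by
  simp [leaf, substT_node]

theorem substT_plug (σ : Subst ℕ) (fs : List Frame) (l : MLit ℕ Unit) (ms : List (MLit ℕ Unit))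
    (hl : MLit.subst σ l = l)
    (hf : ∀ f ∈ fs, MLit.subst σ f.lab = f.lab)
    (hs : ∀ f ∈ fs, ∀ m ∈ f.left ++ f.right, MLit.subst σ m = m) :
    Tree.substT σ (plug fs l ms) = plug fs l (ms.map (MLit.subst σ)) := by
  induction fs with
  | nil => simp [plug, substT_node, hl, substT_leaf]
  | cons f fs ih =>
    simp only [plug, substT_node]
    rw [hf f (by simp)]
    congr 1
    rw [List.map_append, List.map_cons, ih (fun f h => hf f (by simp [h]))
      (fun f h => hs f (by simp [h]))]
    congr 1
    · rw [List.map_map]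
      apply List.map_congr_left
      intro m hm
      simp [substT_leaf, hs f (by simp) m (by simp [hm])]
    · congr 1
      rw [List.map_map]
      apply List.map_congr_left
      intro m hm
      simp [substT_leaf, hs f (by simp) m (by simp [hm])]

theorem size_node {F P : Type} (l : MLit F P) (c : List (Tree F P)) :
    Tree.size (.node l c) = 1 + (c.map Tree.size).sum := by
  rw [Tree.size]; congr 2; simp

theorem size_leaves (ms : List (MLit ℕ Unit)) :
    ((ms.map leaf).map Tree.size).sum = ms.length := by
  induction ms with
  | nil => rfl
  | cons m ms ih =>
    simp only [List.map_cons, List.sum_cons, ih, List.length_cons]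
    simp [leaf, size_node]; omega

theorem size_plug (fs : List Frame) (l : MLit ℕ Unit) (ms : List (MLit ℕ Unit)) :
    Tree.size (plug fs l ms)
      = (fs.map (fun f => 1 + f.left.length + f.right.length)).sum + (1 + ms.length) := by
  induction fs with
  | nil => simp only [plug, size_node, size_leaves]; simp
  | cons f fs ih =>
    simp only [plug, size_node, List.map_append, List.map_cons, List.sum_append, List.sum_cons,
      size_leaves, ih]
    omega

/-- Classification of the positions of `leaf`. -/
theorem subtreeAt_leaf {m : MLit ℕ Unit} {q : List ℕ} {t : Tree ℕ Unit}
    (h : Tree.subtreeAt q (leaf m) = some t) : q = [] ∧ t = leaf m := by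
  cases q with
  | nil => simp [Tree.subtreeAt] at h; exact ⟨rfl, h.symm⟩
  | cons i q => simp [Tree.subtreeAt, leaf] at h

theorem get_cases {α : Type} (a b : List α) (x y : α) (n : ℕ)
    (h : (a ++ x :: b)[n]? = some y) :
    (n = a.length ∧ y = x) ∨ y ∈ a ++ b := by
  rcases lt_trichotomy n a.length with hn | hn | hn
  · rw [List.getElem?_append_left hn] at h
    exact Or.inr (by simp [List.mem_of_getElem? h])
  · rw [get_mid _ _ _ _ hn] at h
    exact Or.inl ⟨hn, by simpa using h.symm⟩
  · rw [List.getElem?_append_right hn.le] at h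
    obtain ⟨k, hk⟩ : ∃ k, n - a.length = k + 1 := ⟨n - a.length - 1, by omega⟩
    rw [hk, List.getElem?_cons_succ] at h
    exact Or.inr (by simp [List.mem_of_getElem? h])

theorem subtree_cases (fs : List Frame) (l : MLit ℕ Unit) (ms : List (MLit ℕ Unit))
    (q : List ℕ) (t : Tree ℕ Unit) (h : Tree.subtreeAt q (plug fs l ms) = some t) :
    ((t.children ≠ [] ∨ ms = []) ∧ q <+: pos fs ∧ (t.label = l ∨ ∃ f ∈ fs, t.label = f.lab)) ∨
    (∃ f ∈ fs, ∃ m ∈ f.left ++ f.right, t = leaf m ∧ ∃ q' i, q = q' ++ [i] ∧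
      Tree.labelAt q' (plug fs l ms) = some f.lab) ∨
    (∃ (i : ℕ) (m : MLit ℕ Unit), ms[i]? = some m ∧ t = leaf m ∧ q = pos fs ++ [i]) := by
  induction fs generalizing q with
  | nil =>
    cases q with
    | nil =>
      left
      simp [plug, Tree.subtreeAt] at h
      subst h
      refine ⟨?_, by simp, Or.inl rfl⟩
      by_cases hm : ms = []
      · exact Or.inr hm
      · left; simp [Tree.children, hm]
    | cons i q =>
      right; right
      simp only [plug, Tree.subtreeAt, List.getElem?_map] at h
      cases hi : ms[i]? with
      | none => simp [hi] at h
      | some m =>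
        simp only [hi, Option.map_some, Option.bind_some] at h
        obtain ⟨rfl, rfl⟩ := subtreeAt_leaf h
        exact ⟨i, m, hi, rfl, rfl⟩
  | cons f fs ih =>
    cases q with
    | nil =>
      left
      simp only [plug, Tree.subtreeAt, Option.some.injEq] at h
      subst h
      exact ⟨Or.inl (by simp [Tree.children]), by simp, Or.inr ⟨f, by simp, rfl⟩⟩
    | cons i q =>
      simp only [plug, Tree.subtreeAt] at h
      rw [Option.bind_eq_some_iff] at h
      obtain ⟨u, hu, h⟩ := h
      rcases get_cases _ _ _ _ _ hu with ⟨hi, rfl⟩ | hmem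
      · have hi' : i = f.left.length := by simpa using hi
        have key : ∀ q', Tree.labelAt (i :: q') (plug (f :: fs) l ms)
            = Tree.labelAt q' (plug fs l ms) := by
          intro q'
          simp only [Tree.labelAt, plug, Tree.subtreeAt]
          rw [get_mid _ _ _ _ hi]; rfl
        rcases ih q h with ⟨h1, h2, h3⟩ | ⟨g, hg, m, hm, ht, q', j, hq, hl⟩ |
          ⟨j, m, hj, ht, hq⟩
        · left
          refine ⟨h1, ?_, ?_⟩
          · simp only [pos, List.map_cons, hi']
            exact List.cons_prefix_cons.2 ⟨rfl, h2⟩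
          · rcases h3 with h3 | ⟨g, hg, h3⟩
            · exact Or.inl h3
            · exact Or.inr ⟨g, by simp [hg], h3⟩
        · right; left
          exact ⟨g, by simp [hg], m, hm, ht, i :: q', j, by simp [hq], by rw [key, hl]⟩
        · right; right
          exact ⟨j, m, hj, ht, by simp [hq, pos, hi']⟩
      · right; left
        rw [← List.map_append, List.mem_map] at hmem
        obtain ⟨m, hm, rfl⟩ := hmem
        obtain ⟨rfl, rfl⟩ := subtreeAt_leaf h
        exact ⟨f, by simp, m, hm, rfl, [], i, rfl, rfl⟩

theorem path_label (fs : List Frame) (l : MLit ℕ Unit) (ms : List (MLit ℕ Unit))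
    (m : MLit ℕ Unit) (h : m = l ∨ ∃ f ∈ fs, m = f.lab) :
    ∃ q, q <+: pos fs ∧ Tree.labelAt q (plug fs l ms) = some m := by
  induction fs with
  | nil =>
    rcases h with rfl | ⟨f, hf, _⟩
    · exact ⟨[], by simp, rfl⟩
    · simp at hf
  | cons f fs ih =>
    have go : (m = l ∨ ∃ f ∈ fs, m = f.lab) →
        ∃ q, q <+: pos (f :: fs) ∧ Tree.labelAt q (plug (f :: fs) l ms) = some m := by
      intro h
      obtain ⟨q, hq, hl⟩ := ih h
      refine ⟨f.left.length :: q, List.cons_prefix_cons.2 ⟨rfl, hq⟩, ?_⟩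
      simp only [Tree.labelAt, plug, Tree.subtreeAt]
      rw [get_mid _ _ _ _ (by simp)]; exact hl
    rcases h with rfl | ⟨g, hg, rfl⟩
    · exact go (Or.inl rfl)
    · rcases List.mem_cons.1 hg with rfl | hg
      · exact ⟨[], by simp, rfl⟩
      · exact go (Or.inr ⟨g, hg, rfl⟩)

/-- Two complementary M-literals with the same argument tuple. -/
def Compl (m m' : MLit ℕ Unit) : Prop :=
  ∃ args S1 S2, (m = .lit true () args S1 ∧ m' = .lit false () args S2)

theorem closed_plug (fs : List Frame) (l : MLit ℕ Unit) (ms : List (MLit ℕ Unit))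
    (hne : ms ≠ [])
    (hs : ∀ f ∈ fs, ∀ m ∈ f.left ++ f.right, MLit.isFalse m ∨ Compl f.lab m)
    (hm : ∀ m ∈ ms, MLit.isFalse m ∨ ∃ m', (m' = l ∨ ∃ f ∈ fs, m' = f.lab) ∧ Compl m' m) :
    ClosedTree (plug fs l ms) := by
  intro q ⟨l', hq⟩
  have hlab : Tree.labelAt q (plug fs l ms) = some l' := by simp [Tree.labelAt, hq, Tree.label]
  rcases subtree_cases _ _ _ _ _ hq with ⟨h1, _⟩ | ⟨f, hf, m, hmem, ht, q', i, hqq, hl⟩ |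
      ⟨i, m, hi, ht, hqq⟩
  · simp [Tree.children, hne] at h1
  · have e : l' = m := by simpa [leaf] using ht
    subst e
    rcases hs f hf _ hmem with h | ⟨args, S1, S2, h1, h2⟩
    · exact Or.inl ⟨q, l', List.prefix_rfl, hlab, h⟩
    · exact Or.inr ⟨q', q, (), args, S1, S2, by simp [hqq], List.prefix_rfl,
        by rw [hl, h1], by rw [hlab, h2]⟩
  · have e : l' = m := by simpa [leaf] using ht
    subst e
    rcases hm _ (List.mem_of_getElem? hi) with h | ⟨m', hm', args, S1, S2, h1, h2⟩
    · exact Or.inl ⟨q, l', List.prefix_rfl, hlab, h⟩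
    · obtain ⟨q', hq', hl⟩ := path_label fs l ms m' hm'
      exact Or.inr ⟨q', q, (), args, S1, S2, by rw [hqq]; exact hq'.trans (by simp),
        List.prefix_rfl, by rw [hl, h1], by rw [hlab, h2]⟩

/-! ### Tableau steps on caterpillar trees -/

def Ok (N : ℕ) (m : MLit ℕ Unit) : Prop := ∀ v ∈ MLit.varsIn m, ∃ j, j ≤ N ∧ v = Var.abs j

structure Good (N : ℕ) (fs : List Frame) (l : MLit ℕ Unit) : Prop where
  lab : Ok N l
  path : ∀ f ∈ fs, Ok N f.lab
  side : ∀ f ∈ fs, ∀ m ∈ f.left ++ f.right, Ok N m ∧ MLit.domS m = ∅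

theorem label_cases {N : ℕ} {fs : List Frame} {l : MLit ℕ Unit} (hG : Good N fs l)
    {ms : List (MLit ℕ Unit)} {q : List ℕ} {m : MLit ℕ Unit}
    (h : Tree.labelAt q (plug fs l ms) = some m) :
    (Ok N m ∧ (q <+: pos fs ∨ MLit.domS m = ∅)) ∨
    (∃ i, ms[i]? = some m ∧ q = pos fs ++ [i]) := by
  simp only [Tree.labelAt, Option.map_eq_some_iff] at h
  obtain ⟨t, ht, rfl⟩ := h
  rcases subtree_cases _ _ _ _ _ ht with ⟨_, h2, h3⟩ | ⟨f, hf, m, hmem, rfl, _⟩ |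
      ⟨i, m, hi, rfl, hqq⟩
  · left
    refine ⟨?_, Or.inl h2⟩
    rcases h3 with h3 | ⟨f, hf, h3⟩
    · rw [h3]; exact hG.lab
    · rw [h3]; exact hG.path f hf
  · left
    exact ⟨(hG.side f hf m hmem).1, Or.inr (hG.side f hf m hmem).2⟩
  · right
    exact ⟨i, hi, hqq⟩

theorem varsIn_cases {N : ℕ} {fs : List Frame} {l : MLit ℕ Unit} (hG : Good N fs l)
    {ms : List (MLit ℕ Unit)} {v : Var} (h : v ∈ Tree.varsIn (plug fs l ms)) :
    (∃ j, j ≤ N ∧ v = Var.abs j) ∨ ∃ m ∈ ms, v ∈ MLit.varsIn m := by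
  obtain ⟨p, m, hm, hv⟩ := h
  rcases label_cases hG hm with ⟨h, _⟩ | ⟨i, hi, _⟩
  · exact Or.inl (h v hv)
  · exact Or.inr ⟨m, List.mem_of_getElem? hi, hv⟩

theorem varsIn_child (fs : List Frame) (l : MLit ℕ Unit)
    {ms : List (MLit ℕ Unit)} {v : Var} {m : MLit ℕ Unit} (hm : m ∈ ms)
    (hv : v ∈ MLit.varsIn m) : v ∈ Tree.varsIn (plug fs l ms) := by
  obtain ⟨i, hi⟩ := List.mem_iff_getElem?.1 hm
  refine ⟨pos fs ++ [i], m, ?_, hv⟩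
  rw [Tree.labelAt, subtreeAt_plug]
  simp [Tree.subtreeAt, hi, leaf, Tree.label]

theorem Good.substT {N : ℕ} {fs : List Frame} {l : MLit ℕ Unit} (hG : Good N fs l)
    (ms : List (MLit ℕ Unit)) (σ : Subst ℕ) (h : ∀ j ≤ N, σ (Var.abs j) = Term.var (Var.abs j)) :
    Tree.substT σ (plug fs l ms) = plug fs l (ms.map (MLit.subst σ)) := by
  have key : ∀ m, Ok N m → MLit.subst σ m = m := by
    intro m hm
    apply MLit.subst_fix
    intro v hv
    obtain ⟨j, hj, rfl⟩ := hm v hv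
    exact h j hj
  exact substT_plug _ _ _ _ (key _ hG.lab) (fun f hf => key _ (hG.path f hf))
    (fun f hf m hm => key _ (hG.side f hf m hm).1)

theorem step_expand {n N : ℕ} {fs : List Frame} {l : MLit ℕ Unit} (hG : Good N fs l)
    (hT : MTableau (Cn n) (plug fs l []))
    (C : MClause ℕ Unit) (hC : C ∈ Cn n) (hTop : MLit.top ∉ C)
    (ρ : Var → Var) (hρ : VarRenaming ρ) (ls : List (MLit ℕ Unit)) (hnd : ls.Nodup)
    (hls : {m | m ∈ ls} = MClause.rename ρ C)
    (hfresh : ∀ m ∈ ls, ∀ j ≤ N, Var.abs j ∉ MLit.varsIn m) :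
    MTableau (Cn n) (plug fs l ls) := by
  refine MTableau.expand hT ⟨pos fs, l, C, ρ, ls, ?_, hC, hTop, hρ, hnd, hls, ?_, ?_⟩
  · have := subtreeAt_plug fs l [] []
    simpa [Tree.subtreeAt] using this
  · intro m hm
    ext v
    simp only [Set.mem_inter_iff, Set.mem_empty_iff_false, iff_false, not_and]
    intro hv hv'
    rcases varsIn_cases hG hv' with ⟨j, hj, rfl⟩ | ⟨m', hm', _⟩
    · exact hfresh m hm j hj hv
    · simp at hm'
  · rw [← replaceAt_plug fs l l [] ls]
    rfl

theorem step_inst {n N : ℕ} {fs : List Frame} {l : MLit ℕ Unit} (hG : Good N fs l)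
    {ms : List (MLit ℕ Unit)} (hT : MTableau (Cn n) (plug fs l ms)) (x : ℕ) (s : Term ℕ)
    (hd : ∀ m ∈ ms, ∀ α ∈ MLit.domS m, α ∉ Term.vars s) :
    MTableau (Cn n) (plug fs l (ms.map (MLit.subst (singleSubst (Var.ord x) s)))) := by
  refine MTableau.inst hT ⟨x, s, ?_, ?_⟩
  · rintro p p' m m' hm hm' hx ⟨α, hα, hαs, _⟩
    rcases label_cases hG hm with ⟨h, _⟩ | ⟨i, hi, rfl⟩
    · obtain ⟨j, _, hj⟩ := h _ hx
      simp at hj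
    · rcases label_cases hG hm' with ⟨_, h | h⟩ | ⟨j, hj, rfl⟩
      · refine ⟨h.trans (by simp), ?_⟩
        rintro rfl
        have := h.length_le
        simp at this
      · rw [h] at hα; simp at hα
      · exact absurd hαs (hd m' (List.mem_of_getElem? hj) α hα)
  · rw [hG.substT]
    intro j _
    simp [singleSubst]

/-- Binary M-literals whose substitution set is given by a family. -/
def ML (pol : Bool) (a b : Var) (I : Set ℕ) (s t : ℕ → Term ℕ) : MLit ℕ Unit :=
  .lit pol () [.var a, .var b] ((fun i => upd2 a b (s i) (t i)) '' I)

theorem upd2_a (a b : Var) (s t : Term ℕ) : upd2 a b s t a = s := by simp [upd2]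
theorem upd2_b {a b : Var} (h : a ≠ b) (s t : Term ℕ) : upd2 a b s t b = t := by
  simp [upd2, h.symm]
theorem upd2_o {a b v : Var} (h : v ≠ a) (h' : v ≠ b) (s t : Term ℕ) :
    upd2 a b s t v = .var v := by
  simp [upd2, h, h']

theorem upd2_dom {a b : Var} (h : a ≠ b) {s t : Term ℕ} (hs : s ≠ .var a) (ht : t ≠ .var b) :
    Subst.dom (upd2 a b s t) = {a, b} := by
  ext v
  simp only [Subst.dom, Set.mem_ofPred_eq, Set.mem_insert_iff, Set.mem_singleton_iff]
  by_cases ha : v = a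
  · subst ha; simp [upd2_a, hs]
  · by_cases hb : v = b
    · subst hb; simp [upd2_b h, ht]
    · simp [upd2_o ha hb, ha, hb]

theorem upd2_compOn {a b : Var} (h : a ≠ b) {s t : Term ℕ} (hs : s ≠ .var a) (ht : t ≠ .var b)
    (σ : Subst ℕ) :
    Subst.compOn (upd2 a b s t) σ = upd2 a b (s.subst σ) (t.subst σ) := by
  funext v
  unfold Subst.compOn
  rw [upd2_dom h hs ht]
  by_cases ha : v = a
  · subst ha; simp [upd2_a]
  · by_cases hb : v = b
    · subst hb; simp [upd2_b h]
    · simp [upd2_o ha hb, ha, hb]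

theorem ML_subst {pol : Bool} {a b : Var} (h : a ≠ b) {I : Set ℕ} {s t : ℕ → Term ℕ}
    (hs : ∀ i ∈ I, s i ≠ .var a) (ht : ∀ i ∈ I, t i ≠ .var b) (σ : Subst ℕ)
    (ha : σ a = .var a) (hb : σ b = .var b) :
    MLit.subst σ (ML pol a b I s t)
      = ML pol a b I (fun i => (s i).subst σ) (fun i => (t i).subst σ) := by
  simp only [ML, MLit.subst]
  congr 1
  · simp [Term.subst_var, ha, hb]
  · rw [Set.image_image]
    apply Set.image_congr
    intro i hi
    exact upd2_compOn h (hs i hi) (ht i hi) σ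

theorem ML_vars {pol : Bool} {a b : Var} {I : Set ℕ} {s t : ℕ → Term ℕ} {v : Var}
    (hv : v ∈ MLit.varsIn (ML pol a b I s t)) :
    v = a ∨ v = b ∨ ∃ i ∈ I, v ∈ Term.vars (s i) ∨ v ∈ Term.vars (t i) := by
  have key : ∀ i w, w ∈ Subst.dom (upd2 a b (s i) (t i)) → w = a ∨ w = b := by
    intro i w hw
    by_contra hc
    push Not at hc
    exact hw (upd2_o hc.1 hc.2 _ _)
  rcases hv with ⟨u, hu, hv⟩ | ⟨σ, ⟨i, hi, rfl⟩, hv⟩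
  · simp only [List.mem_cons, List.not_mem_nil, or_false] at hu
    rcases hu with rfl | rfl
    · exact Or.inl ((Term.mem_vars_var _ _).1 hv)
    · exact Or.inr (Or.inl ((Term.mem_vars_var _ _).1 hv))
  · rcases hv with hv | ⟨w, hw, hv⟩
    · rcases key i v hv with h | h <;> simp [h]
    · by_cases ha : w = a
      · subst ha
        simp only [upd2_a] at hv
        exact Or.inr (Or.inr ⟨i, hi, Or.inl hv⟩)
      · have hb : w = b := (key i w hw).resolve_left ha
        subst hb
        simp only [upd2_b (Ne.symm ha)] at hv
        exact Or.inr (Or.inr ⟨i, hi, Or.inr hv⟩)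

theorem ML_vars_mem {pol : Bool} {a b : Var} (h : a ≠ b) {I : Set ℕ} {s t : ℕ → Term ℕ}
    {v : Var} {i : ℕ} (hi : i ∈ I) (hs : s i ≠ .var a) (ht : t i ≠ .var b)
    (hv : v ∈ Term.vars (s i) ∨ v ∈ Term.vars (t i)) :
    v ∈ MLit.varsIn (ML pol a b I s t) := by
  refine Or.inr ⟨_, ⟨i, hi, rfl⟩, Or.inr ?_⟩
  simp only [upd2_dom h hs ht]
  rcases hv with hv | hv
  · exact ⟨a, by simp, by rw [upd2_a]; exact hv⟩
  · exact ⟨b, by simp, by rw [upd2_b h]; exact hv⟩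

theorem ML_domS_sub {pol : Bool} {a b : Var} {I : Set ℕ} {s t : ℕ → Term ℕ} {v : Var}
    (hv : v ∈ MLit.domS (ML pol a b I s t)) : v = a ∨ v = b := by
  obtain ⟨σ, ⟨i, hi, rfl⟩, hv⟩ := hv
  by_contra hc
  push Not at hc
  exact hv (upd2_o hc.1 hc.2 _ _)

theorem ML_domS {pol : Bool} {a b : Var} (h : a ≠ b) {I : Set ℕ} {s t : ℕ → Term ℕ}
    (hs : ∀ i ∈ I, s i ≠ .var a) (ht : ∀ i ∈ I, t i ≠ .var b) (hI : I.Nonempty) :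
    MLit.domS (ML pol a b I s t) = {a, b} := by
  obtain ⟨i, hi⟩ := hI
  ext v
  constructor
  · intro hv
    exact ML_domS_sub hv
  · intro hv
    refine ⟨_, ⟨i, hi, rfl⟩, ?_⟩
    simp only [upd2_dom h (hs i hi) (ht i hi)]
    exact hv

theorem ML_domS_empty (pol : Bool) (a b : Var) (s t : ℕ → Term ℕ) :
    MLit.domS (ML pol a b ∅ s t) = ∅ := by
  simp [ML, MLit.domS]

theorem ML_isFalse (pol : Bool) (a b : Var) (s t : ℕ → Term ℕ) :
    MLit.isFalse (ML pol a b ∅ s t) := by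
  simp [ML, MLit.isFalse]

theorem ML_rename {pol : Bool} {a b : Var} {I : Set ℕ} {s t : ℕ → Term ℕ}
    (ρ : Var → Var) (hρ : Function.Injective ρ) :
    MLit.rename ρ (ML pol a b I s t)
      = ML pol (ρ a) (ρ b) I (fun i => (s i).subst (renSubst ρ))
          (fun i => (t i).subst (renSubst ρ)) := by
  simp only [ML, MLit.rename]
  congr 1
  · simp [Term.subst_var, renSubst]
  rw [Set.image_image]
  apply Set.image_congr
  intro i hi
  funext v
  unfold Subst.renameBy
  split_ifs with h
  · have h' := h.choose_spec
    generalize h.choose = w at h'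
    subst h'
    by_cases ha : w = a
    · subst ha; simp [upd2_a]
    · have ha' : ρ w ≠ ρ a := fun e => ha (hρ e)
      by_cases hb : w = b
      · subst hb; rw [upd2_b (Ne.symm ha), upd2_b (Ne.symm ha')]
      · have hb' : ρ w ≠ ρ b := fun e => hb (hρ e)
        rw [upd2_o ha hb, upd2_o ha' hb', Term.subst_var]; rfl
  · rw [upd2_o]
    · rintro rfl; exact h ⟨_, rfl⟩
    · rintro rfl; exact h ⟨_, rfl⟩

theorem step_sep {n N : ℕ} {fs : List Frame} {l : MLit ℕ Unit} (hG : Good N fs l)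
    {m1 m2 : List (MLit ℕ Unit)} {pol : Bool} {a b : ℕ} {I : Set ℕ} {s t : ℕ → Term ℕ}
    (hT : MTableau (Cn n) (plug fs l (m1 ++ ML pol (.abs a) (.abs b) I s t :: m2)))
    (hab : a ≠ b) (ha : N < a) (hb : N < b)
    (hs : ∀ i ∈ I, s i ≠ .var (.abs a)) (ht : ∀ i ∈ I, t i ≠ .var (.abs b))
    (I1 : Set ℕ) (hI1 : I1 ⊆ I) (hne : I1.Nonempty) (r1 r2 : Term ℕ)
    (hr : ∀ v, v ∈ Term.vars r1 ∨ v ∈ Term.vars r2 → v ≠ .abs a ∧ v ≠ .abs b)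
    (g : Subst ℕ → Subst ℕ)
    (hg : ∀ i ∈ I1, s i = r1.subst (g (upd2 (.abs a) (.abs b) (s i) (t i))) ∧
      t i = r2.subst (g (upd2 (.abs a) (.abs b) (s i) (t i))) ∧
      ∀ v ∈ Subst.dom (g (upd2 (.abs a) (.abs b) (s i) (t i))),
        (∃ j, N < j ∧ v = .abs j) ∧
        ∀ m ∈ m1 ++ ML pol (.abs a) (.abs b) I s t :: m2, v ∉ MLit.varsIn m)
    (hmax : ∀ i ∈ I, ∀ σ' : Subst ℕ, s i = r1.subst σ' → t i = r2.subst σ' →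
      (∀ v ∈ Subst.dom σ', v ∉ MLit.varsIn (ML pol (.abs a) (.abs b) I s t)) → i ∈ I1)
    (hfix : ∀ m ∈ m1 ++ m2, Var.abs a ∉ MLit.varsIn m ∧ Var.abs b ∉ MLit.varsIn m) :
    MTableau (Cn n) (plug fs l (m1 ++
      MLit.lit pol () [r1, r2] (g '' ((fun i => upd2 (.abs a) (.abs b) (s i) (t i)) '' I1)) ::
        (m2 ++ [ML pol (.abs a) (.abs b) (I \ I1) s t]))) := by
  have hab' : Var.abs a ≠ Var.abs b := by simpa using hab
  set θ : Subst ℕ := upd2 (.abs a) (.abs b) r1 r2 with hθ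
  set A := ML pol (.abs a) (.abs b) I s t with hA
  set T := plug fs l (m1 ++ A :: m2) with hTdef
  have hr1 : r1 ≠ .var (.abs a) := by
    intro e
    exact (hr (.abs a) (Or.inl (by rw [e]; exact (Term.mem_vars_var _ _).2 rfl))).1 rfl
  have hr2 : r2 ≠ .var (.abs b) := by
    intro e
    exact (hr (.abs b) (Or.inr (by rw [e]; exact (Term.mem_vars_var _ _).2 rfl))).2 rfl
  have hdom : MLit.domS A = {Var.abs a, Var.abs b} := ML_domS hab' hs ht (hne.mono hI1)
  have hargs : [Term.var (Var.abs a), Term.var (Var.abs b)].map (Term.subst θ) = [r1, r2] := by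
    simp [Term.subst_var, hθ, upd2_a, upd2_b hab']
  have hargs' : ∀ i, [Term.var (Var.abs a), Term.var (Var.abs b)].map
      (Term.subst (upd2 (.abs a) (.abs b) (s i) (t i))) = [s i, t i] := by
    intro i
    simp [Term.subst_var, upd2_a, upd2_b hab']
  have hfr : ∀ i ∈ I1, ∀ v ∈ Subst.dom (g (upd2 (.abs a) (.abs b) (s i) (t i))),
      Var.isAbs v ∧ v ∉ Tree.varsIn T := by
    intro i hi v hv
    obtain ⟨⟨j, hj, rfl⟩, hj'⟩ := (hg i hi).2.2 v hv
    refine ⟨trivial, fun hc => ?_⟩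
    rcases varsIn_cases hG hc with ⟨k, hk, e⟩ | ⟨m, hm, hmv⟩
    · simp only [Var.abs.injEq] at e; omega
    · exact hj' m hm hmv
  refine MTableau.sep hT ⟨pos fs, m1.length, pol, (), [.var (.abs a), .var (.abs b)],
    (fun i => upd2 (.abs a) (.abs b) (s i) (t i)) '' I, θ, g,
    (fun i => upd2 (.abs a) (.abs b) (s i) (t i)) '' I1,
    (fun i => upd2 (.abs a) (.abs b) (s i) (t i)) '' (I \ I1),
    .node l ((m1 ++ A :: m2).map leaf), leaf A, ?_, ?_, ?_, rfl, ?_, ?_, ?_, ?_, ?_, ?_, ?_⟩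
  · have := subtreeAt_plug fs l (m1 ++ A :: m2) []
    simpa [Tree.subtreeAt] using this
  · simp [Tree.children]
  · simp [Tree.children]
  · rw [hθ, upd2_dom hab' hr1 hr2]
    exact hdom.symm
  · intro v _ hv hv'
    have hv'' : v ∈ MLit.domS A := hv'
    rw [hdom] at hv''
    rw [hargs] at hv
    obtain ⟨u, hu, hvu⟩ := hv
    simp only [List.mem_cons, List.not_mem_nil, or_false] at hu
    have := hr v (by rcases hu with rfl | rfl; exacts [Or.inl hvu, Or.inr hvu])
    rcases hv'' with h | h
    · exact this.1 h
    · exact this.2 h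
  · ext σ
    constructor
    · rintro ⟨i, hi, rfl⟩
      refine ⟨⟨i, hI1 hi, rfl⟩, g (upd2 (.abs a) (.abs b) (s i) (t i)), ?_, hfr i hi⟩
      simp only [hargs, hargs']
      simp [← (hg i hi).1, ← (hg i hi).2.1]
    · rintro ⟨⟨i, hi, rfl⟩, σ', he, hd⟩
      simp only [hargs, hargs'] at he
      simp only [List.map_cons, List.map_nil, List.cons.injEq, and_true] at he
      refine ⟨i, hmax i hi σ' he.1 he.2 ?_, rfl⟩
      intro v hv hc
      exact (hd v hv).2 (varsIn_child fs l (by simp) hc)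
  · rintro σ ⟨i, hi, rfl⟩
    refine ⟨?_, hfr i hi⟩
    simp only [hargs, hargs']
    simp [← (hg i hi).1, ← (hg i hi).2.1]
  · exact (hne.image _).ne_empty
  · ext σ
    constructor
    · rintro ⟨i, hi, rfl⟩
      refine ⟨⟨i, hi.1, rfl⟩, ?_⟩
      rintro ⟨j, hj, e⟩
      have e1 : s j = s i := by
        have := congrFun e (.abs a); simpa [upd2_a] using this
      have e2 : t j = t i := by
        have := congrFun e (.abs b); simpa [upd2_b hab'] using this
      apply hi.2
      refine hmax i hi.1 _ (e1.symm.trans (hg j hj).1) (e2.symm.trans (hg j hj).2.1) ?_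
      intro v hv
      exact ((hg j hj).2.2 v hv).2 A (by simp)
    · rintro ⟨⟨i, hi, rfl⟩, hn⟩
      exact ⟨i, ⟨hi, fun hc => hn ⟨i, hc, rfl⟩⟩, rfl⟩
  · have hmap : ∀ ms : List (MLit ℕ Unit), (∀ m ∈ ms, m ∈ m1 ++ m2) →
        ms.map (MLit.subst θ) = ms := by
      intro ms hms
      conv_rhs => rw [← List.map_id ms]
      apply List.map_congr_left
      intro m hm
      apply MLit.subst_fix
      intro v hv
      have := hfix m (hms m hm)
      apply upd2_o
      · rintro rfl; exact this.1 hv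
      · rintro rfl; exact this.2 hv
    rw [hTdef, hG.substT, hargs, List.map_append, List.map_cons, hmap m1 (by simp +contextual),
      hmap m2 (by simp +contextual), relabelAt_plug, appendChildAt_plug]
    · simp [ML]
    · intro j hj
      apply upd2_o
      · simp; omega
      · simp; omega

/-! ### The construction -/

/-- The renaming shifting abstraction variables by `N + 1`. -/
def shift (N : ℕ) : Var → Var
  | .ord m => .ord m
  | .abs m => .abs (m + N + 1)

theorem shift_ren (N : ℕ) : VarRenaming (shift N) := by
  refine ⟨?_, fun n => ⟨n, rfl⟩, fun n => ⟨n + N + 1, rfl⟩⟩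
  intro v w h
  cases v <;> cases w <;> simp [shift] at h ⊢
  · exact h
  · exact h

theorem l1_eq (n : ℕ) : l1 n = ML true av1 av2 (Set.Icc 1 n) (fun _ => .var xv)
    (fun i => fT i (.var xv)) := by
  unfold l1 ML
  congr 1
  ext σ
  simp only [Set.mem_ofPred_eq, Set.mem_image, Set.mem_Icc]
  constructor
  · rintro ⟨i, h1, h2, rfl⟩; exact ⟨i, ⟨h1, h2⟩, rfl⟩
  · rintro ⟨i, ⟨h1, h2⟩, rfl⟩; exact ⟨i, h1, h2, rfl⟩

theorem l2_eq : l2 = ML false bv1 bv2 {0} (fun _ => .var xv) (fun _ => .var yv) := by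
  simp [l2, ML]

theorem l3_eq : l3 = ML true gv1 gv2 {0} (fun _ => .var xv) (fun _ => fT 0 (.var yv)) := by
  simp [l3, ML]

theorem l4_eq (n : ℕ) : l4 n = ML false dv1 dv2 {i | 1 ≤ i ∧ i + 1 ≤ n}
    (fun i => fT 0 (.var (xi i))) (fun i => fT 0 (.var (xi (i + 1)))) := by
  unfold l4 ML
  congr 1
  ext σ
  simp only [Set.mem_ofPred_eq, Set.mem_image]
  constructor
  · rintro ⟨i, h1, h2, rfl⟩; exact ⟨i, ⟨h1, h2⟩, rfl⟩
  · rintro ⟨i, ⟨h1, h2⟩, rfl⟩; exact ⟨i, h1, h2, rfl⟩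

/-- abstraction variable as a term -/
def vt (c : ℕ) : Term ℕ := .var (.abs c)

theorem mem_vars_vt (c : ℕ) (v : Var) : v ∈ Term.vars (vt c) ↔ v = .abs c :=
  Term.mem_vars_var _ _

theorem fT_ne_var (i : ℕ) (t : Term ℕ) (v : Var) : fT i t ≠ .var v := by
  simp [fT]

theorem single_x (x : ℕ) (s : Term ℕ) :
    Term.subst (singleSubst (.ord x) s) (.var (.ord x)) = s := by
  simp [Term.subst_var, singleSubst]

theorem single_o (x : ℕ) (s : Term ℕ) (v : Var) (h : v ≠ .ord x) :
    Term.subst (singleSubst (.ord x) s) (.var v) = .var v := by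
  simp [Term.subst_var, singleSubst, h]

theorem single_vt (x : ℕ) (s : Term ℕ) (c : ℕ) :
    Term.subst (singleSubst (.ord x) s) (vt c) = vt c :=
  single_o x s _ (by simp)

theorem Ok_ML_empty {N a b : ℕ} (pol : Bool) (s t : ℕ → Term ℕ) (ha : a ≤ N) (hb : b ≤ N) :
    Ok N (ML pol (.abs a) (.abs b) ∅ s t) := by
  intro v hv
  rcases ML_vars hv with rfl | rfl | ⟨i, hi, _⟩
  · exact ⟨a, ha, rfl⟩
  · exact ⟨b, hb, rfl⟩
  · simp at hi

theorem Ok_id {N : ℕ} (pol : Bool) (args : List (Term ℕ))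
    (h : ∀ v ∈ argsVars args, ∃ j, j ≤ N ∧ v = Var.abs j) :
    Ok N (MLit.lit pol () args {Subst.idS}) := by
  rintro v (hv | ⟨σ, hσ, hv⟩)
  · exact h v hv
  · rw [Set.mem_singleton_iff] at hσ
    subst hσ
    simp [Subst.vars, idS_dom] at hv

theorem dom_id (pol : Bool) (args : List (Term ℕ)) :
    MLit.domS (MLit.lit (P := Unit) pol () args {Subst.idS}) = ∅ := by
  simp [MLit.domS, idS_dom]

theorem round1 {n N : ℕ} (hn : 1 ≤ n) {fs : List Frame} {l : MLit ℕ Unit} (hG : Good N fs l)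
    (hT : MTableau (Cn n) (plug fs l [])) (c : ℕ) (hc : c ≤ N) :
    ∃ S FA, MTableau (Cn n) (plug fs l [.lit true () [fT 0 (vt c), vt (N + 3)] S, FA]) ∧
      Ok (N + 3) (.lit true () [fT 0 (vt c), vt (N + 3)] S) ∧ Ok (N + 3) FA ∧
      MLit.domS FA = ∅ ∧ MLit.isFalse FA := by
  -- expansion
  have h1 : MTableau (Cn n) (plug fs l [ML true (.abs (N + 1)) (.abs (N + 2)) (Set.Icc 1 n)
      (fun _ => .var (.ord 0)) (fun i => fT i (.var (.ord 0)))]) := by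
    refine step_expand hG hT {l1 n} (by simp [Cn]) (by simp [l1]) (shift N) (shift_ren N) _
      (by simp) ?_ ?_
    · simp only [MClause.rename, Set.image_singleton, l1_eq, ML_rename _ (shift_ren N).1]
      ext m
      simp [av1, av2, shift, fT_subst, Term.subst_var, renSubst, xv, add_comm, add_left_comm]
    · intro m hm j hj hv
      simp only [List.mem_singleton] at hm
      subst hm
      rcases ML_vars hv with h | h | ⟨i, hi, h | h⟩
      · simp at h; omega
      · simp at h; omega
      · simp [Term.mem_vars_var] at h
      · simp [mem_vars_fT, Term.mem_vars_var] at h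
  -- instantiation
  have h2 : MTableau (Cn n) (plug fs l [ML true (.abs (N + 1)) (.abs (N + 2)) (Set.Icc 1 n)
      (fun _ => fT 0 (vt c)) (fun i => fT i (fT 0 (vt c)))]) := by
    have := step_inst hG h1 0 (fT 0 (vt c)) ?_
    · rw [List.map_singleton, ML_subst (by simp) (by simp) (by simp [fT_ne_var]) _
        (by simp [singleSubst]) (by simp [singleSubst])] at this
      simpa only [fT_subst, single_x] using this
    · intro m hm α hα hv
      simp only [List.mem_singleton] at hm
      subst hm
      rw [mem_vars_fT, mem_vars_vt] at hv
      subst hv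
      rcases ML_domS_sub hα with h | h <;> simp at h <;> omega
  -- separation
  have h3 := step_sep (m1 := []) (m2 := []) hG h2 (by omega) (by omega) (by omega)
    (by simp [fT_ne_var]) (by simp [fT_ne_var]) (Set.Icc 1 n) subset_rfl ⟨1, by simp [hn]⟩
    (fT 0 (vt c)) (vt (N + 3))
    (by
      intro v hv
      rw [mem_vars_fT, mem_vars_vt, mem_vars_vt] at hv
      rcases hv with rfl | rfl <;> constructor <;> simp <;> omega)
    (fun σ => singleSubst (.abs (N + 3)) (σ (.abs (N + 2))))
    (by
      intro i hi
      refine ⟨?_, ?_, ?_⟩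
      · rw [fT_subst]
        congr 1
        have : Var.abs c ≠ Var.abs (N + 3) := by simp; omega
        simp [vt, Term.subst_var, singleSubst, this]
      · simp [vt, Term.subst_var, singleSubst, upd2]
      · intro v hv
        have hv' : v = .abs (N + 3) := by
          by_contra hne
          exact hv (by simp [singleSubst, hne])
        subst hv'
        refine ⟨⟨N + 3, by omega, rfl⟩, ?_⟩
        intro m hm hvm
        simp only [List.nil_append, List.mem_singleton] at hm
        subst hm
        rcases ML_vars hvm with h | h | ⟨i, hi, h | h⟩
        · simp at h
        · simp at h
        · rw [mem_vars_fT, mem_vars_vt] at h; simp at h; omega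
        · rw [mem_vars_fT, mem_vars_fT, mem_vars_vt] at h; simp at h; omega)
    (fun i hi _ _ _ _ => hi) (by simp)
  rw [Set.sdiff_self] at h3
  refine ⟨_, _, h3, ?_, Ok_ML_empty _ _ _ (by omega) (by omega), ML_domS_empty _ _ _ _ _,
    ML_isFalse _ _ _ _ _⟩
  rintro v (⟨u, hu, hv⟩ | ⟨σ, ⟨_, ⟨i, hi, rfl⟩, rfl⟩, hv⟩)
  · simp only [List.mem_cons, List.not_mem_nil, or_false] at hu
    rcases hu with rfl | rfl
    · rw [mem_vars_fT, mem_vars_vt] at hv; exact ⟨c, by omega, hv⟩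
    · rw [mem_vars_vt] at hv; exact ⟨N + 3, by omega, hv⟩
  · have hd : ∀ w ∈ Subst.dom (singleSubst (Var.abs (N + 3)) (upd2 (.abs (N + 1)) (.abs (N + 2))
        (fT 0 (vt c)) (fT i (fT 0 (vt c))) (.abs (N + 2)))), w = .abs (N + 3) := by
      intro w hw
      by_contra hne
      exact hw (by simp [singleSubst, hne])
    rcases hv with hv | ⟨w, hw, hv⟩
    · exact ⟨N + 3, le_rfl, hd v hv⟩
    · have := hd w hw
      subst this
      simp only [singleSubst, if_true] at hv
      rw [upd2_b (by simp), mem_vars_fT, mem_vars_fT, mem_vars_vt] at hv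
      exact ⟨c, by omega, hv⟩

theorem round2 {n N : ℕ} {fs : List Frame} {l : MLit ℕ Unit} (hG : Good N fs l)
    (hT : MTableau (Cn n) (plug fs l [])) (c d : ℕ) (hc : c ≤ N) (hd : d ≤ N) :
    ∃ F2 F3, MTableau (Cn n) (plug fs l [.lit false () [fT 0 (vt c), vt d] {Subst.idS},
        .lit true () [fT 0 (vt c), fT 0 (vt d)] {Subst.idS}, F2, F3]) ∧
      (Ok (N + 6) F2 ∧ MLit.domS F2 = ∅ ∧ MLit.isFalse F2) ∧
      (Ok (N + 6) F3 ∧ MLit.domS F3 = ∅ ∧ MLit.isFalse F3) := by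
  -- expansion
  have h1 : MTableau (Cn n) (plug fs l [ML false (.abs (N + 3)) (.abs (N + 4)) {0}
      (fun _ => .var (.ord 0)) (fun _ => .var (.ord 1)),
      ML true (.abs (N + 5)) (.abs (N + 6)) {0}
      (fun _ => .var (.ord 0)) (fun _ => fT 0 (.var (.ord 1)))]) := by
    refine step_expand hG hT {l2, l3} (by simp [Cn]) (by simp [l2, l3]) (shift N) (shift_ren N) _
      (by simp [ML]) ?_ ?_
    · simp only [MClause.rename, Set.image_pair, l2_eq, l3_eq, ML_rename _ (shift_ren N).1]
      ext m
      simp [bv1, bv2, gv1, gv2, shift, fT_subst, Term.subst_var, renSubst, xv, yv, add_comm,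
        add_left_comm]
    · intro m hm j hj hv
      simp only [List.mem_cons, List.not_mem_nil, or_false] at hm
      rcases hm with rfl | rfl
      · rcases ML_vars hv with h | h | ⟨i, hi, h | h⟩
        · simp at h; omega
        · simp at h; omega
        · simp [Term.mem_vars_var] at h
        · simp [Term.mem_vars_var] at h
      · rcases ML_vars hv with h | h | ⟨i, hi, h | h⟩
        · simp at h; omega
        · simp at h; omega
        · simp [Term.mem_vars_var] at h
        · simp [mem_vars_fT, Term.mem_vars_var] at h
  -- instantiations
  have h2 : MTableau (Cn n) (plug fs l [ML false (.abs (N + 3)) (.abs (N + 4)) {0}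
      (fun _ => fT 0 (vt c)) (fun _ => .var (.ord 1)),
      ML true (.abs (N + 5)) (.abs (N + 6)) {0}
      (fun _ => fT 0 (vt c)) (fun _ => fT 0 (.var (.ord 1)))]) := by
    have := step_inst hG h1 0 (fT 0 (vt c)) ?_
    · rw [List.map_cons, List.map_singleton,
        ML_subst (by simp) (by simp) (by simp) _
          (by simp [singleSubst]) (by simp [singleSubst]),
        ML_subst (by simp) (by simp) (by simp [fT_ne_var]) _
          (by simp [singleSubst]) (by simp [singleSubst])] at this
      simpa only [fT_subst, single_x, single_o 0 _ (.ord 1) (by simp)] using this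
    · intro m hm α hα hv
      rw [mem_vars_fT, mem_vars_vt] at hv
      subst hv
      simp only [List.mem_cons, List.not_mem_nil, or_false] at hm
      rcases hm with rfl | rfl <;> rcases ML_domS_sub hα with h | h <;> simp at h <;> omega
  have h3 : MTableau (Cn n) (plug fs l [ML false (.abs (N + 3)) (.abs (N + 4)) {0}
      (fun _ => fT 0 (vt c)) (fun _ => vt d),
      ML true (.abs (N + 5)) (.abs (N + 6)) {0}
      (fun _ => fT 0 (vt c)) (fun _ => fT 0 (vt d))]) := by
    have := step_inst hG h2 1 (vt d) ?_
    · rw [List.map_cons, List.map_singleton,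
        ML_subst (by simp) (by simp [fT_ne_var]) (by simp) _
          (by simp [singleSubst]) (by simp [singleSubst]),
        ML_subst (by simp) (by simp [fT_ne_var]) (by simp [fT_ne_var]) _
          (by simp [singleSubst]) (by simp [singleSubst])] at this
      simpa only [fT_subst, single_x, single_vt] using this
    · intro m hm α hα hv
      rw [mem_vars_vt] at hv
      subst hv
      simp only [List.mem_cons, List.not_mem_nil, or_false] at hm
      rcases hm with rfl | rfl <;> rcases ML_domS_sub hα with h | h <;> simp at h <;> omega
  -- separations
  have h4 := step_sep (m1 := []) hG h3 (by omega) (by omega) (by omega)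
    (by simp [fT_ne_var]) (by simp [vt]; omega) {0} subset_rfl ⟨0, by simp⟩
    (fT 0 (vt c)) (vt d)
    (by
      intro v hv
      rw [mem_vars_fT, mem_vars_vt, mem_vars_vt] at hv
      rcases hv with rfl | rfl <;> constructor <;> simp <;> omega)
    (fun _ => Subst.idS)
    (by
      intro i hi
      simp [Term.subst_idS, idS_dom])
    (fun i hi _ _ _ _ => hi)
    (by
      intro m hm
      simp only [List.nil_append, List.mem_singleton] at hm
      subst hm
      constructor <;> intro hv
      all_goals
        rcases ML_vars hv with h | h | ⟨i, hi, h | h⟩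
        · simp at h
        · simp at h
        · rw [mem_vars_fT, mem_vars_vt] at h; simp at h; omega
        · rw [mem_vars_fT, mem_vars_vt] at h; simp at h; omega)
  rw [Set.sdiff_self, Set.image_singleton, Set.image_singleton] at h4
  simp only [List.nil_append, List.cons_append] at h4
  have h5 := step_sep (m1 := [_]) hG h4 (by omega) (by omega) (by omega)
    (by simp [fT_ne_var]) (by simp [fT_ne_var]) {0} subset_rfl ⟨0, by simp⟩
    (fT 0 (vt c)) (fT 0 (vt d))
    (by
      intro v hv
      rw [mem_vars_fT, mem_vars_fT, mem_vars_vt, mem_vars_vt] at hv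
      rcases hv with rfl | rfl <;> constructor <;> simp <;> omega)
    (fun _ => Subst.idS)
    (by
      intro i hi
      simp [Term.subst_idS, idS_dom])
    (fun i hi _ _ _ _ => hi)
    (by
      intro m hm
      have hOk : Ok (N + 4) m := by
        simp only [List.nil_append, List.cons_append, List.mem_cons, List.not_mem_nil,
          or_false] at hm
        rcases hm with rfl | rfl
        · apply Ok_id
          rintro v ⟨u, hu, hv⟩
          simp only [List.mem_cons, List.not_mem_nil, or_false] at hu
          rcases hu with rfl | rfl
          · rw [mem_vars_fT, mem_vars_vt] at hv; exact ⟨c, by omega, hv⟩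
          · rw [mem_vars_vt] at hv; exact ⟨d, by omega, hv⟩
        · exact Ok_ML_empty _ _ _ (by omega) (by omega)
      constructor <;> intro hv <;> obtain ⟨j, hj, e⟩ := hOk _ hv <;> simp at e <;> omega)
  rw [Set.sdiff_self, Set.image_singleton, Set.image_singleton] at h5
  exact ⟨_, _, h5,
    ⟨Ok_ML_empty _ _ _ (by omega) (by omega), ML_domS_empty _ _ _ _ _, ML_isFalse _ _ _ _ _⟩,
    ⟨Ok_ML_empty _ _ _ (by omega) (by omega), ML_domS_empty _ _ _ _ _, ML_isFalse _ _ _ _ _⟩⟩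

theorem Ok.mono {N M : ℕ} (h : N ≤ M) {m : MLit ℕ Unit} (hm : Ok N m) : Ok M m := by
  intro v hv
  obtain ⟨j, hj, e⟩ := hm v hv
  exact ⟨j, by omega, e⟩

theorem Good.snoc {N M : ℕ} (h : N ≤ M) {fs : List Frame} {l l' : MLit ℕ Unit}
    {m1 m2 : List (MLit ℕ Unit)} (hG : Good N fs l) (hl : Ok M l')
    (hm : ∀ m ∈ m1 ++ m2, Ok M m ∧ MLit.domS m = ∅) :
    Good M (fs ++ [⟨l, m1, m2⟩]) l' := by
  refine ⟨hl, ?_, ?_⟩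
  · intro f hf
    rcases List.mem_append.1 hf with hf | hf
    · exact (hG.path f hf).mono h
    · simp only [List.mem_singleton] at hf
      subst hf
      exact hG.lab.mono h
  · intro f hf m hmem
    rcases List.mem_append.1 hf with hf | hf
    · exact ⟨(hG.side f hf m hmem).1.mono h, (hG.side f hf m hmem).2⟩
    · simp only [List.mem_singleton] at hf
      subst hf
      exact hm m hmem

/-- The `k`-th chain variable. -/
def bI (k : ℕ) : ℕ := 10 * k - 7

theorem rounds {n : ℕ} (k : ℕ) (hk : k + 1 ≤ n ∨ k = 0) :
    ∃ fs l, Good (10 * k) fs l ∧ MTableau (Cn n) (plug fs l []) ∧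
      (∀ f ∈ fs, ∀ m ∈ f.left ++ f.right, MLit.isFalse m ∨ Compl f.lab m) ∧
      (∀ j < k, ∃ S, MLit.lit true () [fT 0 (vt (bI j)), fT 0 (vt (bI (j + 1)))] S = l ∨
        ∃ f ∈ fs, MLit.lit true () [fT 0 (vt (bI j)), fT 0 (vt (bI (j + 1)))] S = f.lab) ∧
      (fs.map (fun f => 1 + f.left.length + f.right.length)).sum = 6 * k := by
  induction k with
  | zero =>
    refine ⟨[], .top, ⟨?_, by simp, by simp⟩, ?_, by simp, by simp, by simp⟩
    · intro v hv; exact absurd hv (by simp [MLit.varsIn])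
    · simpa [plug] using MTableau.init
  | succ k ih =>
    obtain ⟨fs, l, hG, hT, hcl, hl, hsz⟩ := ih (Or.inl (by omega))
    obtain ⟨S, FA, hT1, hA, hFA, hFd, hFf⟩ := round1 (by omega) hG hT (bI k)
      (by unfold bI; omega)
    have e1 := plug_append fs l (.lit true () [fT 0 (vt (bI k)), vt (10 * k + 3)] S) [] [FA]
    rw [List.nil_append] at e1
    rw [e1] at hT1
    have hG1 := hG.snoc (M := 10 * k + 3) (m1 := []) (m2 := [FA]) (by omega) hA
      (by simp [hFA, hFd])
    obtain ⟨F2, F3, hT2, ⟨hF2, hF2d, hF2f⟩, ⟨hF3, hF3d, hF3f⟩⟩ :=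
      round2 hG1 hT1 (bI k) (10 * k + 3) (by unfold bI; omega) le_rfl
    have hargs : ∀ t ∈ [vt (10 * k + 3), fT 0 (vt (10 * k + 3))],
        ∀ v ∈ argsVars [fT 0 (vt (bI k)), t], ∃ j, j ≤ 10 * k + 10 ∧ v = Var.abs j := by
      rintro t ht v ⟨u, hu, hv⟩
      simp only [List.mem_cons, List.not_mem_nil, or_false] at hu ht
      rcases hu with rfl | rfl
      · rw [mem_vars_fT, mem_vars_vt] at hv; exact ⟨bI k, by unfold bI; omega, hv⟩
      · rcases ht with rfl | rfl
        · rw [mem_vars_vt] at hv; exact ⟨_, by omega, hv⟩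
        · rw [mem_vars_fT, mem_vars_vt] at hv; exact ⟨_, by omega, hv⟩
    have e2 := plug_append (fs ++ [⟨l, [], [FA]⟩])
      (.lit true () [fT 0 (vt (bI k)), vt (10 * k + 3)] S)
      (.lit true () [fT 0 (vt (bI k)), fT 0 (vt (10 * k + 3))] {Subst.idS})
      [.lit false () [fT 0 (vt (bI k)), vt (10 * k + 3)] {Subst.idS}] [F2, F3]
    rw [List.singleton_append] at e2
    rw [e2] at hT2
    have hb : bI (k + 1) = 10 * k + 3 := by unfold bI; omega
    refine ⟨_, _, hG1.snoc (M := 10 * (k + 1)) (by omega) ?_ ?_, hT2, ?_, ?_, ?_⟩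
    · exact Ok_id _ _ (hargs _ (by simp))
    · intro m hm
      simp only [List.singleton_append, List.mem_cons, List.not_mem_nil, or_false] at hm
      rcases hm with rfl | rfl | rfl
      · exact ⟨Ok_id _ _ (hargs _ (by simp)), dom_id _ _⟩
      · exact ⟨hF2.mono (by omega), hF2d⟩
      · exact ⟨hF3.mono (by omega), hF3d⟩
    · intro f hf m hm
      simp only [List.mem_append, List.mem_singleton] at hf
      rcases hf with (hf | rfl) | rfl
      · exact hcl f hf m hm
      · simp only [List.nil_append, List.mem_singleton] at hm
        subst hm; exact Or.inl hFf
      · simp only [List.singleton_append, List.mem_cons, List.not_mem_nil, or_false] at hm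
        rcases hm with rfl | rfl | rfl
        · exact Or.inr ⟨_, _, _, rfl, rfl⟩
        · exact Or.inl hF2f
        · exact Or.inl hF3f
    · intro j hj
      rcases Nat.lt_succ_iff_lt_or_eq.1 hj with hj | rfl
      · obtain ⟨S', h | ⟨f, hf, h⟩⟩ := hl j hj
        · exact ⟨S', Or.inr ⟨⟨l, [], [FA]⟩, by simp, h⟩⟩
        · exact ⟨S', Or.inr ⟨f, by simp [hf], h⟩⟩
      · exact ⟨{Subst.idS}, Or.inl (by rw [hb])⟩
    · simp [hsz]; omega

theorem ML_congr {pol : Bool} {a b : Var} {I : Set ℕ} {s t s' t' : ℕ → Term ℕ}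
    (hs : ∀ i ∈ I, s i = s' i) (ht : ∀ i ∈ I, t i = t' i) :
    ML pol a b I s t = ML pol a b I s' t' := by
  unfold ML
  congr 1
  apply Set.image_congr
  intro i hi
  rw [hs i hi, ht i hi]

/-- Arguments of the last clause after `j` instantiations. -/
def X (j i : ℕ) : Term ℕ := if i < j then vt (bI (i - 1)) else .var (.ord (i + 1))

theorem X_succ (j i : ℕ) :
    Term.subst (singleSubst (.ord (j + 1)) (vt (bI (j - 1)))) (X j i) = X (j + 1) i := by
  unfold X
  rcases lt_trichotomy i j with h | h | h
  · rw [if_pos h, if_pos (by omega), single_vt]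
  · subst h
    rw [if_neg (by omega), if_pos (by omega), single_x]
  · rw [if_neg (by omega), if_neg (by omega), single_o]
    simp; omega

def D (i : ℕ) : MLit ℕ Unit :=
  .lit false () [fT 0 (vt (bI i)), fT 0 (vt (bI (i + 1)))] {Subst.idS}

theorem Ok_D {N i : ℕ} (h : bI (i + 1) ≤ N) : Ok N (D i) := by
  apply Ok_id
  rintro v ⟨u, hu, hv⟩
  simp only [List.mem_cons, List.not_mem_nil, or_false] at hu
  rcases hu with rfl | rfl <;> rw [mem_vars_fT, mem_vars_vt] at hv
  · exact ⟨_, by unfold bI at *; omega, hv⟩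
  · exact ⟨_, h, hv⟩

theorem final_inst {n N : ℕ} (hN : N = 10 * (n - 1)) {fs : List Frame} {l : MLit ℕ Unit}
    (hG : Good N fs l) (hT : MTableau (Cn n) (plug fs l [])) (j : ℕ) (hj : j ≤ n + 1) :
    MTableau (Cn n) (plug fs l [ML false (.abs (N + 7)) (.abs (N + 8)) {i | 1 ≤ i ∧ i + 1 ≤ n}
      (fun i => fT 0 (X j i)) (fun i => fT 0 (X j (i + 1)))]) := by
  induction j with
  | zero =>
    refine step_expand hG hT {l4 n} (by simp [Cn]) (by simp [l4]) (shift N) (shift_ren N) _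
      (by simp) ?_ ?_
    · simp only [MClause.rename, Set.image_singleton, l4_eq, ML_rename _ (shift_ren N).1]
      ext m
      simp [dv1, dv2, shift, fT_subst, Term.subst_var, renSubst, xi, X, add_comm, add_left_comm]
    · intro m hm j hj hv
      simp only [List.mem_singleton] at hm
      subst hm
      rcases ML_vars hv with h | h | ⟨i, hi, h | h⟩
      · simp at h; omega
      · simp at h; omega
      · simp [mem_vars_fT, Term.mem_vars_var, X] at h
      · simp [mem_vars_fT, Term.mem_vars_var, X] at h
  | succ j ih =>
    have := step_inst hG (ih (by omega)) (j + 1) (vt (bI (j - 1))) ?_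
    · rw [List.map_singleton, ML_subst (by simp) (by simp [fT_ne_var]) (by simp [fT_ne_var]) _
        (by simp [singleSubst]) (by simp [singleSubst])] at this
      simpa only [fT_subst, X_succ] using this
    · intro m hm α hα hv
      simp only [List.mem_singleton] at hm
      subst hm
      rw [mem_vars_vt] at hv
      subst hv
      unfold bI at hα
      rcases ML_domS_sub hα with h | h <;> simp at h <;> omega

theorem final_sep {n N : ℕ} (hN : N = 10 * (n - 1)) {fs : List Frame} {l : MLit ℕ Unit}
    (hG : Good N fs l) (hT : MTableau (Cn n) (plug fs l [])) (j : ℕ) (hj : j ≤ n - 1) :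
    MTableau (Cn n) (plug fs l ((List.range j).map D ++
      [ML false (.abs (N + 7)) (.abs (N + 8)) {i | j + 1 ≤ i ∧ i + 1 ≤ n}
      (fun i => fT 0 (vt (bI (i - 1)))) (fun i => fT 0 (vt (bI i)))])) := by
  induction j with
  | zero =>
    have := final_inst hN hG hT (n + 1) le_rfl
    rw [ML_congr (s' := fun i => fT 0 (vt (bI (i - 1)))) (t' := fun i => fT 0 (vt (bI i)))] at this
    · simpa using this
    · rintro i ⟨h1, h2⟩
      simp only [X]; rw [if_pos (by omega)]
    · rintro i ⟨h1, h2⟩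
      simp only [X]; rw [if_pos (by omega)]; simp
  | succ j ih =>
    have hmem : j + 1 ∈ {i | j + 1 ≤ i ∧ i + 1 ≤ n} := ⟨le_rfl, by omega⟩
    have h := step_sep (m2 := []) hG (ih (by omega)) (by omega) (by omega) (by omega)
      (by simp [fT_ne_var]) (by simp [fT_ne_var]) {j + 1} (by simpa using hmem)
      ⟨j + 1, rfl⟩ (fT 0 (vt (bI j))) (fT 0 (vt (bI (j + 1))))
      (by
        intro v hv
        rw [mem_vars_fT, mem_vars_fT, mem_vars_vt, mem_vars_vt] at hv
        unfold bI at hv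
        rcases hv with rfl | rfl <;> constructor <;> simp <;> omega)
      (fun _ => Subst.idS)
      (by
        intro i hi
        rw [Set.mem_singleton_iff] at hi
        subst hi
        simp [Term.subst_idS, idS_dom])
      (by
        rintro i ⟨hi1, hi2⟩ σ' _ h2 hd
        rw [fT_subst, fT_inj] at h2
        have hfix : Term.subst σ' (vt (bI (j + 1))) = vt (bI (j + 1)) := by
          rw [vt, Term.subst_var]
          by_contra hne
          refine hd (.abs (bI (j + 1))) hne ?_
          exact ML_vars_mem (by simp) hmem (fT_ne_var _ _ _) (fT_ne_var _ _ _)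
            (Or.inr ((mem_vars_fT _ _ _).2 ((mem_vars_vt _ _).2 rfl)))
        rw [hfix] at h2
        have h3 := h2.2
        simp only [vt, Term.var.injEq, Var.abs.injEq, bI] at h3
        rw [Set.mem_singleton_iff]
        omega)
      (by
        intro m hm
        simp only [List.append_nil, List.mem_map, List.mem_range] at hm
        obtain ⟨i, hi, rfl⟩ := hm
        have hOk : Ok N (D i) := Ok_D (by unfold bI; omega)
        constructor <;> intro hv <;> obtain ⟨j, hj, e⟩ := hOk _ hv <;> simp at e <;> omega)
    rw [Set.image_singleton, Set.image_singleton] at h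
    have hset : {i | j + 1 ≤ i ∧ i + 1 ≤ n} \ {j + 1} = {i | j + 1 + 1 ≤ i ∧ i + 1 ≤ n} := by
      ext i
      simp only [Set.mem_sdiff, Set.mem_ofPred_eq, Set.mem_singleton_iff]
      omega
    rw [hset] at h
    simpa [List.range_succ, D] using h

/-- for every `n` there is a closed M-tableau for `𝒞ⁿ` whose number of
nodes is linear in `n`. -/
theorem exists_linear_closed_mtableau :
    ∃ a b : ℕ, ∀ n : ℕ, ∃ T : Tree ℕ Unit,
      MTableau (Cn n) T ∧ ClosedTree T ∧ Tree.size T ≤ a * n + b := by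
  refine ⟨7, 2, fun n => ?_⟩
  obtain ⟨fs, l, hG, hT, hcl, hl, hsz⟩ := rounds (n := n) (n - 1) (by omega)
  refine ⟨_, final_sep rfl hG hT (n - 1) le_rfl, ?_, ?_⟩
  · refine closed_plug _ _ _ (by simp) hcl ?_
    intro m hm
    simp only [List.mem_append, List.mem_map, List.mem_range, List.mem_singleton] at hm
    rcases hm with ⟨i, hi, rfl⟩ | rfl
    · right
      obtain ⟨S, h⟩ := hl i hi
      exact ⟨_, h, _, _, _, rfl, rfl⟩
    · left
      have : {i | n - 1 + 1 ≤ i ∧ i + 1 ≤ n} = (∅ : Set ℕ) := by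
        ext i
        simp only [Set.mem_ofPred_eq, Set.mem_empty_iff_false, iff_false]
        omega
      rw [this]
      exact ML_isFalse _ _ _ _ _
  · rw [size_plug, hsz]
    simp
    omega

end MTab
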